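/- For all x, y ∈ X and t ≥ 0, the N-clause evolution factorizes over the ancillas: E_t(|x⟩⟨y| ⊗ |1̄⟩⟨1̄|) = |x⟩⟨y| ⊗ A(t), where A(t) is the matrix indexed by (Fin N → Bool) × (Fin N → Bool) with entries A(t)(ā, b̄) = Π_{j=1}^{N} Mⱼ(t)(ā j, b̄ j), and Mⱼ(t) is the 2×2 matrix equal to e^{−γt}|1⟩⟨1| + (1 − e^{−γt})|Cⱼ(x)⟩⟨Cⱼ(x)| if Cⱼ(x) = Cⱼ(y), and equal to e^{−γt/2}|1⟩⟨1| if Cⱼ(x) ≠ Cⱼ(y). -/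

import Mathlib

open Matrix Filter
open scoped Kronecker Topology

attribute [local instance] Matrix.normedAddCommGroup Matrix.normedSpace

noncomputable section

/-- The computational basis of `n` qubits, `X = {0,1}ⁿ`. -/
abbrev QubitBasis (n : ℕ) := Fin n → Bool

/-- Evaluation of the 3-literal clause with indices `i₁ i₂ i₃` and bits `b₁ b₂ b₃`:
`C(x) = ¬(x i₁ = b₁ ∧ x i₂ = b₂ ∧ x i₃ = b₃)`. -/
def clauseEval {n : ℕ} (i₁ i₂ i₃ : Fin n) (b₁ b₂ b₃ : Bool) (x : QubitBasis n) : Bool :=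
  ! (decide (x i₁ = b₁) && decide (x i₂ = b₂) && decide (x i₃ = b₃))

/-- The Lindblad operator `Lⱼ` attached to the `j`-th clause of an `N`-clause network:
`Lⱼ((x,ā),(y,b̄)) = 1` iff `x = y`, `Cⱼ(x) = false`, `ā j = false`, `b̄ j = true`, and
`ā k = b̄ k` for all `k ≠ j`. -/
def jumpOpN {n N : ℕ} (C : Fin N → QubitBasis n → Bool) (j : Fin N) :
    Matrix (QubitBasis n × (Fin N → Bool)) (QubitBasis n × (Fin N → Bool)) ℂ :=
  Matrix.of fun p q =>
    if p.1 = q.1 ∧ C j p.1 = false ∧ p.2 j = false ∧ q.2 j = true ∧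
        (∀ k, k ≠ j → p.2 k = q.2 k) then 1 else 0

/-- The Lindbladian `ℒ(ρ) = γ (L ρ L† − (1/2)(L†L ρ + ρ L†L))` as a linear endomorphism
of the matrix space. -/
def lindbladian {d : Type*} [Fintype d] [DecidableEq d] (γ : ℝ) (L : Matrix d d ℂ) :
    Matrix d d ℂ →ₗ[ℂ] Matrix d d ℂ :=
  (γ : ℂ) • ((LinearMap.mulRight ℂ Lᴴ).comp (LinearMap.mulLeft ℂ L)
    - (1 / 2 : ℂ) • (LinearMap.mulLeft ℂ (Lᴴ * L) + LinearMap.mulRight ℂ (Lᴴ * L)))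

/-- The evolution `E_t = exp(t·ℒ)`, the exponential of the endomorphism `ℒ`. -/
def evol {d : Type*} [Fintype d] [DecidableEq d]
    (L : Matrix d d ℂ →ₗ[ℂ] Matrix d d ℂ) (t : ℝ) :
    Matrix d d ℂ →L[ℂ] Matrix d d ℂ :=
  haveI : IsTopologicalRing (Matrix d d ℂ →L[ℂ] Matrix d d ℂ) :=
    @NonUnitalSeminormedRing.toIsTopologicalRing _
      (@NormedRing.toNonUnitalNormedRing _
        ContinuousLinearMap.toNormedRing).toNonUnitalSeminormedRing
  NormedSpace.exp ((t : ℂ) • LinearMap.toContinuousLinearMap L)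

/-- The single-ancilla `2×2` factor `Mⱼ(t)` of the evolved ancilla state:
`e^{−γt}|1⟩⟨1| + (1 − e^{−γt})|c⟩⟨c|` if `Cⱼ(x) = c = Cⱼ(y)`, and `e^{−γt/2}|1⟩⟨1|`
if `Cⱼ(x) ≠ Cⱼ(y)`. -/
def ancillaFactor (γ t : ℝ) (cx cy : Bool) : Matrix Bool Bool ℂ :=
  if cx = cy then
    (Real.exp (-(γ * t)) : ℂ) • Matrix.single true true (1 : ℂ)
      + ((1 - Real.exp (-(γ * t)) : ℝ) : ℂ) • Matrix.single cx cx (1 : ℂ)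
  else (Real.exp (-(γ * t / 2)) : ℂ) • Matrix.single true true (1 : ℂ)

theorem exp_flow_unique {E : Type*} [NormedAddCommGroup E] [NormedSpace ℂ E] [CompleteSpace E]
    (A : E →L[ℂ] E) (v : ℝ → E) (hv : ∀ t, HasDerivAt v (A (v t)) t) (t : ℝ) :
    NormedSpace.exp ((t : ℂ) • A) (v 0) = v t := by
  have hw : ∀ s : ℝ, HasDerivAt (fun s : ℝ => NormedSpace.exp (((t - s : ℝ) : ℂ) • A) (v s)) 0 s := by
    intro s
    have h1 := (hasDerivAt_exp_smul_const (𝕂 := ℂ) A (((t - s : ℝ)) : ℂ))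
    have h2 : HasDerivAt (fun s : ℝ => ((t - s : ℝ) : ℂ)) (-1) s := by
      have := ((hasDerivAt_id s).const_sub t).ofReal_comp
      simpa using this
    have h3 := h1.scomp s h2
    have h4 : HasDerivAt (fun s : ℝ => NormedSpace.exp (((t - s : ℝ) : ℂ) • A) (v s))
        (((-1 : ℂ) • (NormedSpace.exp (((t - s : ℝ) : ℂ) • A) * A)) (v s)
          + NormedSpace.exp (((t - s : ℝ) : ℂ) • A) (A (v s))) s := by
      have hb := ((ContinuousLinearMap.apply ℂ E).flip.bilinearRestrictScalars ℝ).hasFDerivAt_of_bilinear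
        h3.hasFDerivAt (hv s).hasFDerivAt
      have := hb.hasDerivAt
      refine this.congr_deriv ?_
      change NormedSpace.exp (((t - s : ℝ) : ℂ) • A) ((1 : ℝ) • A (v s))
        + ((1 : ℝ) • ((-1 : ℂ) • (NormedSpace.exp (((t - s : ℝ) : ℂ) • A) * A))) (v s) = _
      rw [one_smul, one_smul, add_comm]
    refine h4.congr_deriv ?_
    simp
  have hc := is_const_of_deriv_eq_zero (fun s => (hw s).differentiableAt) (fun s => (hw s).deriv) 0 t
  simpa using hc

theorem jump_mul_apply {n N : ℕ} (C : Fin N → QubitBasis n → Bool) (j : Fin N)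
    (ρ : Matrix (QubitBasis n × (Fin N → Bool)) (QubitBasis n × (Fin N → Bool)) ℂ)
    (p q : QubitBasis n × (Fin N → Bool)) :
    (jumpOpN C j * ρ) p q =
      if C j p.1 = false ∧ p.2 j = false then ρ (p.1, Function.update p.2 j true) q else 0 := by
  rw [Matrix.mul_apply, Finset.sum_eq_single (p.1, Function.update p.2 j true)]
  · by_cases h : C j p.1 = false ∧ p.2 j = false
    · rw [if_pos h]
      simp only [jumpOpN, Matrix.of_apply]
      rw [if_pos ⟨trivial, h.1, h.2, by simp, fun k hk => by simp [hk]⟩, one_mul]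
    · rw [if_neg h]
      simp only [jumpOpN, Matrix.of_apply]
      rw [if_neg (fun h' => h ⟨h'.2.1, h'.2.2.1⟩), zero_mul]
  · intro r _ hr
    simp only [jumpOpN, Matrix.of_apply]
    rw [if_neg, zero_mul]
    rintro ⟨h1, -, -, h4, h5⟩
    apply hr
    refine Prod.ext h1.symm (funext fun k => ?_)
    by_cases hk : k = j
    · subst hk; simp [h4]
    · simp [hk, h5 k hk]
  · simp

theorem jumpH_mul_apply {n N : ℕ} (C : Fin N → QubitBasis n → Bool) (j : Fin N)
    (ρ : Matrix (QubitBasis n × (Fin N → Bool)) (QubitBasis n × (Fin N → Bool)) ℂ)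
    (p q : QubitBasis n × (Fin N → Bool)) :
    ((jumpOpN C j)ᴴ * ρ) p q =
      if C j p.1 = false ∧ p.2 j = true then ρ (p.1, Function.update p.2 j false) q else 0 := by
  rw [Matrix.mul_apply, Finset.sum_eq_single (p.1, Function.update p.2 j false)]
  · by_cases h : C j p.1 = false ∧ p.2 j = true
    · rw [if_pos h]
      simp only [jumpOpN, Matrix.of_apply, Matrix.conjTranspose_apply]
      rw [if_pos ⟨trivial, h.1, by simp, h.2, fun k hk => by simp [hk]⟩, star_one, one_mul]
    · rw [if_neg h]
      simp only [jumpOpN, Matrix.of_apply, Matrix.conjTranspose_apply]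
      rw [if_neg (fun h' => h ⟨h'.2.1, h'.2.2.2.1⟩), star_zero, zero_mul]
  · intro r _ hr
    simp only [jumpOpN, Matrix.of_apply, Matrix.conjTranspose_apply]
    rw [if_neg, star_zero, zero_mul]
    rintro ⟨h1, -, h3, -, h5⟩
    apply hr
    refine Prod.ext h1 (funext fun k => ?_)
    by_cases hk : k = j
    · subst hk; simp [h3]
    · simp [hk, h5 k hk]
  · simp

theorem mul_jumpH_apply {n N : ℕ} (C : Fin N → QubitBasis n → Bool) (j : Fin N)
    (ρ : Matrix (QubitBasis n × (Fin N → Bool)) (QubitBasis n × (Fin N → Bool)) ℂ)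
    (p q : QubitBasis n × (Fin N → Bool)) :
    (ρ * (jumpOpN C j)ᴴ) p q =
      if C j q.1 = false ∧ q.2 j = false then ρ p (q.1, Function.update q.2 j true) else 0 := by
  have h : ρ * (jumpOpN C j)ᴴ = (jumpOpN C j * ρᴴ)ᴴ := by simp
  rw [h, Matrix.conjTranspose_apply, jump_mul_apply]
  split_ifs <;> simp

theorem num_mul_apply {n N : ℕ} (C : Fin N → QubitBasis n → Bool) (j : Fin N)
    (ρ : Matrix (QubitBasis n × (Fin N → Bool)) (QubitBasis n × (Fin N → Bool)) ℂ)
    (p q : QubitBasis n × (Fin N → Bool)) :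
    ((jumpOpN C j)ᴴ * jumpOpN C j * ρ) p q =
      if C j p.1 = false ∧ p.2 j = true then ρ p q else 0 := by
  rw [Matrix.mul_assoc, jumpH_mul_apply, jump_mul_apply]
  by_cases h : C j p.1 = false ∧ p.2 j = true
  · rw [if_pos h, if_pos h, if_pos ⟨h.1, by simp⟩]
    simp only [Function.update_idem]
    rw [← h.2, Function.update_eq_self]
  · rw [if_neg h, if_neg h]

theorem mul_num_apply {n N : ℕ} (C : Fin N → QubitBasis n → Bool) (j : Fin N)
    (ρ : Matrix (QubitBasis n × (Fin N → Bool)) (QubitBasis n × (Fin N → Bool)) ℂ)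
    (p q : QubitBasis n × (Fin N → Bool)) :
    (ρ * ((jumpOpN C j)ᴴ * jumpOpN C j)) p q =
      if C j q.1 = false ∧ q.2 j = true then ρ p q else 0 := by
  have h : ρ * ((jumpOpN C j)ᴴ * jumpOpN C j) = ((jumpOpN C j)ᴴ * jumpOpN C j * ρᴴ)ᴴ := by
    simp [Matrix.mul_assoc]
  rw [h, Matrix.conjTranspose_apply, num_mul_apply]
  split_ifs <;> simp

theorem lindbladian_apply_entry {n N : ℕ} (C : Fin N → QubitBasis n → Bool) (j : Fin N) (γ : ℝ)
    (ρ : Matrix (QubitBasis n × (Fin N → Bool)) (QubitBasis n × (Fin N → Bool)) ℂ)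
    (p q : QubitBasis n × (Fin N → Bool)) :
    lindbladian γ (jumpOpN C j) ρ p q =
      (γ : ℂ) * ((if C j q.1 = false ∧ q.2 j = false then
          (if C j p.1 = false ∧ p.2 j = false then
            ρ (p.1, Function.update p.2 j true) (q.1, Function.update q.2 j true) else 0) else 0)
        - (1 / 2) * ((if C j p.1 = false ∧ p.2 j = true then ρ p q else 0)
          + (if C j q.1 = false ∧ q.2 j = true then ρ p q else 0))) := by
  have : lindbladian γ (jumpOpN C j) ρ = (γ : ℂ) • (jumpOpN C j * ρ * (jumpOpN C j)ᴴ
      - (1 / 2 : ℂ) • ((jumpOpN C j)ᴴ * jumpOpN C j * ρ + ρ * ((jumpOpN C j)ᴴ * jumpOpN C j))) := rfl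
  rw [this, Matrix.smul_apply, Matrix.sub_apply, Matrix.smul_apply, Matrix.add_apply,
    mul_jumpH_apply, num_mul_apply, mul_num_apply, jump_mul_apply, smul_eq_mul, smul_eq_mul]

theorem ancillaFactor_hasDerivAt (γ t : ℝ) (cx cy a b : Bool) :
    HasDerivAt (fun t => ancillaFactor γ t cx cy a b)
      ((γ : ℂ) * ((if cy = false ∧ b = false then
          (if cx = false ∧ a = false then ancillaFactor γ t cx cy true true else 0) else 0)
        - (1 / 2) * ((if cx = false ∧ a = true then ancillaFactor γ t cx cy a b else 0)
          + (if cy = false ∧ b = true then ancillaFactor γ t cx cy a b else 0)))) t := by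
  have h1 : HasDerivAt (fun t : ℝ => ((Real.exp (-(γ * t)) : ℝ) : ℂ))
      (-(γ : ℂ) * (Real.exp (-(γ * t)) : ℝ)) t := by
    have := (((hasDerivAt_id t).const_mul γ).neg.exp).ofReal_comp
    refine this.congr_deriv ?_
    simp [mul_comm]
  have h2 : HasDerivAt (fun t : ℝ => ((Real.exp (-(γ * t / 2)) : ℝ) : ℂ))
      (-(γ : ℂ) / 2 * (Real.exp (-(γ * t / 2)) : ℝ)) t := by
    have := ((((hasDerivAt_id t).const_mul γ).div_const 2).neg.exp).ofReal_comp
    refine this.congr_deriv ?_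
    simp only [Pi.neg_apply, id]
    push_cast
    ring
  have h3 : HasDerivAt (fun t : ℝ => ((1 - Real.exp (-(γ * t)) : ℝ) : ℂ))
      ((γ : ℂ) * (Real.exp (-(γ * t)) : ℝ)) t := by
    have := h1.const_sub 1
    have e : (fun t : ℝ => ((1 - Real.exp (-(γ * t)) : ℝ) : ℂ))
        = fun t : ℝ => 1 - ((Real.exp (-(γ * t)) : ℝ) : ℂ) := by
      funext s; push_cast; rfl
    rw [e]
    refine this.congr_deriv ?_
    ring
  have h4 : HasDerivAt (fun t : ℝ => ((Real.exp (-(γ * t)) : ℝ) : ℂ) + ((1 - Real.exp (-(γ * t)) : ℝ) : ℂ))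
      0 t := by
    have := h1.add h3
    refine this.congr_deriv ?_
    ring
  have h0 : HasDerivAt (fun _ : ℝ => (0 : ℂ)) 0 t := hasDerivAt_const t 0
  cases cx <;> cases cy <;> cases a <;> cases b <;>
    simp only [ancillaFactor, Matrix.add_apply, Matrix.smul_apply, Matrix.single_apply, smul_eq_mul,
      if_true, if_false, reduceCtorEq, and_true, and_false, and_self, true_and, false_and,
      mul_one, mul_zero, add_zero, zero_add, sub_zero, Bool.true_eq_false, Bool.false_eq_true] <;>
    first
    | exact h0
    | exact h3
    | exact h4
    | exact h1.congr_deriv (by ring1)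
    | exact h2.congr_deriv (by ring1)

theorem prod_state_hasDerivAt {n N : ℕ} (C : Fin N → QubitBasis n → Bool) (γ : ℝ)
    (x y : QubitBasis n) (t : ℝ) :
    HasDerivAt (fun t : ℝ => Matrix.single x y (1 : ℂ) ⊗ₖ
          Matrix.of (fun a b : Fin N → Bool =>
            ∏ j, ancillaFactor γ t (C j x) (C j y) (a j) (b j)))
      ((∑ j, lindbladian γ (jumpOpN C j)) (Matrix.single x y (1 : ℂ) ⊗ₖ
          Matrix.of (fun a b : Fin N → Bool =>
            ∏ j, ancillaFactor γ t (C j x) (C j y) (a j) (b j)))) t := by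
  refine hasDerivAt_pi.2 fun p => hasDerivAt_pi.2 fun q => ?_
  obtain ⟨x', a⟩ := p
  obtain ⟨y', b⟩ := q
  rw [LinearMap.sum_apply, Matrix.sum_apply]
  simp only [lindbladian_apply_entry, Matrix.kroneckerMap_apply, Matrix.of_apply]
  by_cases hxy : x = x' ∧ y = y'
  · obtain ⟨rfl, rfl⟩ := hxy
    simp only [Matrix.single_apply_same, one_mul]
    have := HasDerivAt.fun_finsetProd (u := Finset.univ) (fun j _ =>
      ancillaFactor_hasDerivAt γ t (C j x) (C j y) (a j) (b j))
    refine this.congr_deriv ?_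
    symm
    refine Finset.sum_congr rfl fun j _ => ?_
    have e1 : ∀ a b : Fin N → Bool, ∏ k, ancillaFactor γ t (C k x) (C k y) (a k) (b k)
        = (∏ k ∈ Finset.univ.erase j, ancillaFactor γ t (C k x) (C k y) (a k) (b k))
          * ancillaFactor γ t (C j x) (C j y) (a j) (b j) := fun a b =>
      (Finset.prod_erase_mul _ _ (Finset.mem_univ j)).symm
    have e2 : ∏ k ∈ Finset.univ.erase j, ancillaFactor γ t (C k x) (C k y)
          (Function.update a j true k) (Function.update b j true k)
        = ∏ k ∈ Finset.univ.erase j, ancillaFactor γ t (C k x) (C k y) (a k) (b k) := by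
      refine Finset.prod_congr rfl fun k hk => ?_
      have := Finset.ne_of_mem_erase hk
      simp [this]
    rw [e1 a b, e1 (Function.update a j true), e2]
    simp only [Function.update_self, smul_eq_mul]
    split_ifs <;> ring
  · have : Matrix.single x y (1 : ℂ) x' y' = 0 := by
      rw [Matrix.single_apply, if_neg hxy]
    simp only [this, zero_mul, ite_self, add_zero, mul_zero, sub_zero, Finset.sum_const_zero]
    exact hasDerivAt_const t 0

theorem prod_state_zero {n N : ℕ} (C : Fin N → QubitBasis n → Bool) (γ : ℝ)
    (x y : QubitBasis n) :
    (Matrix.single x y (1 : ℂ) ⊗ₖ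
          Matrix.of (fun a b : Fin N → Bool =>
            ∏ j, ancillaFactor γ 0 (C j x) (C j y) (a j) (b j)))
      = Matrix.single (x, fun _ => true) (y, fun _ => true) 1 := by
  have hA : ∀ cx cy, ancillaFactor γ 0 cx cy = Matrix.single true true 1 := by
    intro cx cy; simp [ancillaFactor]
  ext ⟨x', a⟩ ⟨y', b⟩
  simp only [hA, Matrix.kroneckerMap_apply, Matrix.of_apply]
  by_cases h : (x = x' ∧ y = y') ∧ ((fun _ => true) = a ∧ (fun _ => true) = b)
  · obtain ⟨⟨rfl, rfl⟩, rfl, rfl⟩ := h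
    simp
  · rw [Matrix.single_apply (i := (x, fun _ => true)), if_neg]
    · by_cases h1 : x = x' ∧ y = y'
      · have h2 : ∃ k, ¬ (true = a k ∧ true = b k) := by
          by_contra hc
          push Not at hc
          exact h ⟨h1, funext fun k => (hc k).1, funext fun k => (hc k).2⟩
        obtain ⟨k, hk⟩ := h2
        rw [Finset.prod_eq_zero (Finset.mem_univ k), mul_zero]
        rw [Matrix.single_apply, if_neg hk]
      · rw [Matrix.single_apply, if_neg h1, zero_mul]
    · rintro ⟨h1, h2⟩
      rw [Prod.mk.injEq] at h1 h2
      exact h ⟨⟨h1.1, h2.1⟩, h1.2, h2.2⟩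

/-- the `N`-clause evolution of `|x⟩⟨y| ⊗ |1̄⟩⟨1̄|` factorizes over the
ancillas: `E_t(|x⟩⟨y| ⊗ |1̄⟩⟨1̄|) = |x⟩⟨y| ⊗ A(t)` with
`A(t)(ā,b̄) = Πⱼ Mⱼ(t)(ā j, b̄ j)`. -/
theorem evol_factorizes {n N : ℕ} (hn : 1 ≤ n) (hN : 1 ≤ N)
    (i₁ i₂ i₃ : Fin N → Fin n)
    (h₁₂ : ∀ j, i₁ j ≠ i₂ j) (h₁₃ : ∀ j, i₁ j ≠ i₃ j) (h₂₃ : ∀ j, i₂ j ≠ i₃ j)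
    (b₁ b₂ b₃ : Fin N → Bool) (γ : ℝ) (hγ : 0 < γ)
    (C : Fin N → QubitBasis n → Bool)
    (hC : ∀ j, C j = clauseEval (i₁ j) (i₂ j) (i₃ j) (b₁ j) (b₂ j) (b₃ j))
    (x y : QubitBasis n) (t : ℝ) (ht : 0 ≤ t) :
    evol (∑ j, lindbladian γ (jumpOpN C j)) t
        (Matrix.single (x, fun _ => true) (y, fun _ => true) 1)
      = Matrix.single x y (1 : ℂ) ⊗ₖ
          Matrix.of (fun a b : Fin N → Bool =>
            ∏ j, ancillaFactor γ t (C j x) (C j y) (a j) (b j)) := by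
  rw [← prod_state_zero C γ x y]
  exact exp_flow_unique (LinearMap.toContinuousLinearMap (∑ j, lindbladian γ (jumpOpN C j)))
    (fun t : ℝ => Matrix.single x y (1 : ℂ) ⊗ₖ
          Matrix.of (fun a b : Fin N → Bool =>
            ∏ j, ancillaFactor γ t (C j x) (C j y) (a j) (b j)))
    (fun t => prod_state_hasDerivAt C γ x y t) t
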